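/- Every metric space induced by a connected chordal graph on n vertices, where n ≥ 2, either has at least n distinct lines or else has a line that consists of all n vertices. -/

import Mathlib

/-- `b` lies between `a` and `c` in the metric space induced by a graph `G`. -/
def SimpleGraph.Btw {V : Type*} (G : SimpleGraph V) (a b c : V) : Prop :=
  a ≠ b ∧ b ≠ c ∧ a ≠ c ∧ G.dist a b + G.dist b c = G.dist a c

/-- The line determined by two distinct vertices `u` and `v`. -/
def SimpleGraph.line {V : Type*} (G : SimpleGraph V) (u v : V) : Set V :=
  {u, v} ∪ {p | G.Btw p u v ∨ G.Btw u p v ∨ G.Btw u v p}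

/-- A graph is chordal if every cycle of length at least four has a chord;
equivalently, it contains no induced cycle of length at least four. -/
def SimpleGraph.IsChordal {V : Type*} (G : SimpleGraph V) : Prop :=
  ∀ n : ℕ, 4 ≤ n → IsEmpty (SimpleGraph.cycleGraph n ↪g G)

namespace SimpleGraph

variable {V : Type*} {G : SimpleGraph V}

/-- In a chordal graph, the ends of an edge both attached to a connected set of other vertices
have a common neighbour in this set. -/
theorem IsChordal.exists_common_adj (hG : G.IsChordal) {K : Set V}
    (hK : (G.induce K).Preconnected) {x u a b : V} (hx : x ∉ K) (hu : u ∉ K) (hxu : G.Adj x u)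
    (ha : a ∈ K) (hb : b ∈ K) (hxa : G.Adj x a) (hub : G.Adj u b) :
    ∃ w ∈ K, G.Adj x w ∧ G.Adj u w := by
  let S : Set V := insert x (insert u K)
  let H : SimpleGraph V :=
    { Adj := fun c d => G.Adj c d ∧ c ∈ S ∧ d ∈ S ∧ s(c, d) ≠ s(x, u)
      symm := ⟨fun c d h => ⟨h.1.symm, h.2.2.1, h.2.1, by rw [Sym2.eq_swap]; exact h.2.2.2⟩⟩
      loopless := ⟨fun c h => G.loopless.irrefl c h.1⟩ }
  have hab : H.Reachable a b := by
    let f : G.induce K →g H :=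
      { toFun := Subtype.val
        map_rel' := by
          rintro ⟨c, hc⟩ ⟨d, hd⟩ hcd
          refine ⟨hcd, Or.inr (Or.inr hc), Or.inr (Or.inr hd), fun h => ?_⟩
          rcases Sym2.eq_iff.1 h with ⟨rfl, rfl⟩ | ⟨rfl, rfl⟩
          · exact hx hc
          · exact hx hd }
    exact (hK ⟨a, ha⟩ ⟨b, hb⟩).map f
  have hxa' : H.Adj x a := by
    refine ⟨hxa, Or.inl rfl, Or.inr (Or.inr ha), fun h => ?_⟩
    rcases Sym2.eq_iff.1 h with ⟨_, rfl⟩ | ⟨rfl, rfl⟩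
    · exact hu ha
    · exact hu ‹_›
  have hub' : H.Adj b u := by
    refine ⟨hub.symm, Or.inr (Or.inr hb), Or.inr (Or.inl rfl), fun h => ?_⟩
    rcases Sym2.eq_iff.1 h with ⟨rfl, _⟩ | ⟨rfl, rfl⟩
    · exact hx hb
    · exact hu hb
  have hreach : H.Reachable x u := hxa'.reachable.trans (hab.trans hub'.reachable)
  obtain ⟨p, hp⟩ := hreach.exists_walk_length_eq_dist
  have hdist : ∀ i ≤ p.length, H.Reachable x (p.getVert i) ∧ H.dist x (p.getVert i) = i := by
    intro i hi
    have h1 := dist_le (p.take i)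
    have h2 := dist_le (p.drop i)
    have h3 := (p.take i).reachable.dist_triangle_left u
    rw [Walk.take_length] at h1
    rw [Walk.drop_length] at h2
    exact ⟨(p.take i).reachable, by omega⟩
  have hinj : ∀ i ≤ p.length, ∀ j ≤ p.length, p.getVert i = p.getVert j → i = j := by
    intro i hi j hj h
    rw [← (hdist i hi).2, h, (hdist j hj).2]
  have hmem : ∀ i ≤ p.length, p.getVert i ∈ S := by
    intro i hi
    rcases hi.lt_or_eq with h | rfl
    · exact (p.adj_getVert_succ h).2.1
    · simp [S]
  have hadj : ∀ i j, i < j → j ≤ p.length →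
      (G.Adj (p.getVert i) (p.getVert j) ↔ j = i + 1 ∨ (i = 0 ∧ j = p.length)) := by
    intro i j hij hj
    constructor
    · intro h
      by_cases he : s(p.getVert i, p.getVert j) = s(x, u)
      · right
        have h0 := hinj 0 (by omega)
        have hl := hinj p.length le_rfl
        rw [Walk.getVert_zero] at h0
        rw [Walk.getVert_length] at hl
        rcases Sym2.eq_iff.1 he with ⟨e1, e2⟩ | ⟨e1, e2⟩
        · exact ⟨(h0 i (by omega) e1.symm).symm, (hl j hj e2.symm).symm⟩
        · have := h0 j hj e2.symm
          omega
      · left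
        have hH : H.Adj (p.getVert i) (p.getVert j) := ⟨h, hmem i (by omega), hmem j hj, he⟩
        have h1 := (hdist i (by omega)).1.dist_triangle_left (p.getVert j)
        rw [(hdist i (by omega)).2, (hdist j hj).2, dist_eq_one_iff_adj.2 hH] at h1
        omega
    · rintro (rfl | ⟨rfl, rfl⟩)
      · exact (p.adj_getVert_succ (by omega)).1
      · simpa using hxu
  have hlen : p.length < 3 := by
    by_contra! hlen
    refine (hG (p.length + 1) (by omega)).false ⟨⟨fun i => p.getVert i.1, ?_⟩, ?_⟩
    · intro i j h
      exact Fin.ext (hinj _ (by omega) _ (by omega) h)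
    · intro i j
      change G.Adj (p.getVert i.1) (p.getVert j.1) ↔ _
      rw [cycleGraph_adj']
      rcases lt_trichotomy i j with h | rfl | h
      · rw [hadj i j h (by omega), Fin.coe_sub_iff_le.2 h.le, Fin.coe_sub_iff_lt.2 h]
        have : i.1 < j.1 := h
        omega
      · simp
      · rw [G.adj_comm, hadj j i h (by omega), Fin.coe_sub_iff_le.2 h.le, Fin.coe_sub_iff_lt.2 h]
        have : j.1 < i.1 := h
        omega
  have hpos : p.length ≠ 0 := by
    rw [hp]
    exact (hreach.pos_dist_of_ne hxu.ne).ne'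
  have hone : p.length ≠ 1 := by
    rw [hp]
    exact fun h => (dist_eq_one_iff_adj.1 h).2.2.2 rfl
  have h1 := (hadj 0 1 (by omega) (by omega)).2 (Or.inl rfl)
  have h2 := (hadj 1 p.length (by omega) le_rfl).2 (Or.inl (by omega))
  rw [Walk.getVert_zero] at h1
  rw [Walk.getVert_length] at h2
  refine ⟨p.getVert 1, ?_, h1, h2.symm⟩
  rcases hmem 1 (by omega) with h | h | h
  · exact (h1.ne h.symm).elim
  · exact (h2.ne h).elim
  · exact h

theorem preconnected_induce_insert {K : Set V} (hK : (G.induce K).Preconnected) {v k : V}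
    (hk : k ∈ K) (h : G.Adj v k) : (G.induce (insert v K)).Preconnected := by
  have := (induce_union_connected (induce_pair_connected_of_adj h).preconnected hK
    ⟨k, by simp, hk⟩).preconnected
  rwa [Set.insert_union, Set.singleton_union, Set.insert_eq_of_mem hk] at this

/-- In a chordal graph, two vertices attached to a connected set `K` and sharing a neighbour
that is not attached to `K` are adjacent. -/
theorem IsChordal.adj_of_common_adj (hG : G.IsChordal) {K : Set V}
    (hK : (G.induce K).Preconnected) {x u a b c : V} (hx : x ∉ K) (hxu : x ≠ u)
    (ha : a ∈ K) (hb : b ∈ K) (hxa : G.Adj x a) (hub : G.Adj u b)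
    (hc : c ∉ K) (hcK : ∀ k ∈ K, ¬ G.Adj c k) (hcx : G.Adj c x) (hcu : G.Adj c u) :
    G.Adj x u := by
  obtain ⟨w, rfl | hw, hxw, hcw⟩ := hG.exists_common_adj (preconnected_induce_insert hK hb hub)
    (x := x) (u := c) (a := a) (b := u) (by simp [hx, hxu]) (by simp [hc, hcu.ne]) hcx.symm
    (by simp [ha]) (by simp) hxa hcu
  · exact hxw
  · exact (hcK w hw hcw).elim

theorem Connected.dist_le_dist_add_one (hconn : G.Connected) (s : V) {a b : V} (h : G.Adj a b) :
    G.dist s a ≤ G.dist s b + 1 := by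
  have := hconn.dist_triangle (u := s) (v := b) (w := a)
  rwa [dist_eq_one_iff_adj.2 h.symm] at this

theorem Connected.exists_adj_dist_eq (hconn : G.Connected) {a b : V} (h : b ≠ a) :
    ∃ c, G.Adj b c ∧ G.dist b a = G.dist c a + 1 := by
  obtain ⟨p, hp⟩ := hconn.exists_walk_length_eq_dist b a
  cases p with
  | nil => exact (h rfl).elim
  | @cons _ c _ hbc q =>
    refine ⟨c, hbc, ?_⟩
    have h1 := dist_le q
    have h2 := hconn.dist_le_dist_add_one a hbc
    rw [dist_comm (u := a), dist_comm (u := a)] at h2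
    rw [Walk.length_cons] at hp
    omega

/-- A geodesic entering a set of vertices passes through a vertex attached to this set. -/
theorem Connected.exists_boundary_dist_eq (hconn : G.Connected) {K : Set V} {a b : V}
    (ha : a ∈ K) (hb : b ∉ K) :
    ∃ z ∉ K, ∃ z' ∈ K, G.Adj z z' ∧ G.dist b a = G.dist b z + G.dist z a := by
  induction hn : G.dist b a generalizing b with
  | zero => exact (hb ((hconn.dist_eq_zero_iff.1 hn) ▸ ha)).elim
  | succ n ih =>
    obtain ⟨c, hbc, hc⟩ := hconn.exists_adj_dist_eq (a := a) (b := b) (by rintro rfl; exact hb ha)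
    by_cases hcK : c ∈ K
    · exact ⟨b, hb, c, hcK, hbc, by simp [hn]⟩
    · obtain ⟨z, hz, z', hz', hzz, h⟩ := ih hcK (by omega)
      refine ⟨z, hz, z', hz', hzz, ?_⟩
      have h1 := hconn.dist_triangle (u := b) (v := z) (w := a)
      have h2 := hconn.dist_triangle (u := b) (v := c) (w := z)
      rw [dist_eq_one_iff_adj.2 hbc] at h2
      omega

/-- In a chordal graph, vertices of a sphere that are attached to the same connected set outside
the corresponding ball are adjacent. -/
theorem IsChordal.adj_of_dist_eq (hG : G.IsChordal) (hconn : G.Connected) (s : V) {d : ℕ}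
    {K : Set V} (hK : (G.induce K).Preconnected) (hd : ∀ k ∈ K, d < G.dist s k) {x u a b : V}
    (hx : G.dist s x = d) (hu : G.dist s u = d) (hxu : x ≠ u) (ha : a ∈ K) (hb : b ∈ K)
    (hxa : G.Adj x a) (hub : G.Adj u b) : G.Adj x u := by
  induction d generalizing K x u a b with
  | zero => exact (hxu ((hconn.dist_eq_zero_iff.1 hx).symm.trans (hconn.dist_eq_zero_iff.1 hu))).elim
  | succ d ih =>
    have parent : ∀ v, G.dist s v = d + 1 → ∃ c, G.Adj v c ∧ G.dist s c = d := by
      intro v hv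
      obtain ⟨c, hvc, h⟩ := hconn.exists_adj_dist_eq (a := s) (b := v)
        (by rintro rfl; simp at hv)
      rw [dist_comm, dist_comm (u := c)] at h
      exact ⟨c, hvc, by omega⟩
    have hxK : x ∉ K := fun h => by have := hd x h; omega
    have huK : u ∉ K := fun h => by have := hd u h; omega
    have far : ∀ c, G.dist s c = d → ∀ k ∈ K, ¬ G.Adj c k := by
      intro c hc k hk h
      have := hd k hk
      have := hconn.dist_le_dist_add_one s h.symm
      omega
    have common : ∀ c, G.dist s c = d → G.Adj x c → G.Adj u c → G.Adj x u := by
      intro c hc hxc huc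
      exact hG.adj_of_common_adj hK hxK hxu ha hb hxa hub
        (fun h => by have := hd c h; omega) (far c hc) hxc.symm huc.symm
    obtain ⟨x', hxx', hx'⟩ := parent x hx
    obtain ⟨u', huu', hu'⟩ := parent u hu
    by_cases he : x' = u'
    · exact common x' hx' hxx' (he ▸ huu')
    have hK' := preconnected_induce_insert (preconnected_induce_insert hK hb hub)
      (Set.mem_insert_of_mem u ha) hxa
    have hd' : ∀ k ∈ insert x (insert u K), d < G.dist s k := by
      rintro k (rfl | rfl | hk)
      · omega
      · omega
      · have := hd k hk
        omega
    have hx'u' := ih hK' hd' hx' hu' he (a := x) (b := u) (by simp) (by simp)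
      hxx'.symm huu'.symm
    obtain ⟨w, rfl | rfl | hw, hxw, huw⟩ := hG.exists_common_adj hK'
      (fun h => by have := hd' _ h; omega) (fun h => by have := hd' _ h; omega) hx'u'
      (a := x) (b := u) (by simp) (by simp) hxx'.symm huu'.symm
    · exact common u' hu' huw.symm huu'
    · exact common x' hx' hxx' hxw.symm
    · exact (far x' hx' w hw hxw).elim

/-- A vertex is simplicial if its neighbours are pairwise adjacent. -/
def IsSimplicial (G : SimpleGraph V) (s : V) : Prop :=
  ∀ ⦃a b⦄, G.Adj s a → G.Adj s b → a ≠ b → G.Adj a b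

/-- Dirac's theorem: every nonempty finite set of vertices of a chordal graph contains a vertex
whose neighbours in the set are pairwise adjacent. -/
theorem IsChordal.exists_simplicial_mem [Finite V] (hG : G.IsChordal) (S : Set V)
    (hS : S.Nonempty) :
    ∃ s ∈ S, ∀ a ∈ S, ∀ b ∈ S, G.Adj s a → G.Adj s b → a ≠ b → G.Adj a b := by
  induction S using (wellFounded_lt (α := Set V)).induction with
  | _ S ih =>
    by_cases hclique : ∀ a ∈ S, ∀ b ∈ S, a ≠ b → G.Adj a b
    · obtain ⟨s, hs⟩ := hS
      exact ⟨s, hs, fun a ha b hb _ _ hab => hclique a ha b hb hab⟩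
    push Not at hclique
    obtain ⟨p, hp, q, hq, hpq, hnpq⟩ := hclique
    let F : Set (Set V) := {M | M ⊆ S ∧ M.Nonempty ∧ (G.induce M).Preconnected ∧
      ∃ b ∈ S, b ∉ M ∧ ∀ m ∈ M, ¬ G.Adj b m}
    have hF : F.Nonempty := by
      refine ⟨{p}, by simpa using hp, by simp, ?_, q, hq, by simpa using hpq.symm, ?_⟩
      · rintro ⟨a, rfl⟩ ⟨b, rfl⟩
        rfl
      · rintro m rfl h
        exact hnpq h.symm
    obtain ⟨M, ⟨hMS, ⟨m₀, hm₀⟩, hMc, b₀, hb₀⟩, hmax⟩ := F.toFinite.exists_maximal hF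
    let B : Set V := {b | b ∈ S ∧ b ∉ M ∧ ∀ m ∈ M, ¬ G.Adj b m}
    have hBS : B < S := by
      refine ⟨fun b hb => hb.1, fun h => ?_⟩
      exact (h (hMS hm₀)).2.1 hm₀
    obtain ⟨b, hb, hsimp⟩ := ih B hBS ⟨b₀, hb₀⟩
    have attached : ∀ t ∈ S, t ∉ B → t ∉ M → ∃ m ∈ M, G.Adj t m := by
      intro t ht htB htM
      by_contra! h
      exact htB ⟨ht, htM, h⟩
    have join : ∀ t ∈ S, t ∉ B → t ∉ M → ∀ c ∈ B, G.Adj t c := by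
      intro t ht htB htM c hc
      by_contra htc
      obtain ⟨m, hm, htm⟩ := attached t ht htB htM
      have hins : insert t M ∈ F := by
        refine ⟨Set.insert_subset ht hMS, by simp, preconnected_induce_insert hMc hm htm,
          c, hc.1, ?_, ?_⟩
        · rintro (rfl | h)
          · exact htB hc
          · exact hc.2.1 h
        · rintro k (rfl | hk) h
          · exact htc h.symm
          · exact hc.2.2 k hk h
      exact htM (hmax hins (Set.subset_insert t M) (Set.mem_insert t M))
    refine ⟨b, hb.1, fun a ha c hc hba hbc hac => ?_⟩
    have haM : a ∉ M := fun h => hb.2.2 a h hba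
    have hcM : c ∉ M := fun h => hb.2.2 c h hbc
    by_cases haB : a ∈ B
    · by_cases hcB : c ∈ B
      · exact hsimp a haB c hcB hba hbc hac
      · exact (join c hc hcB hcM a haB).symm
    · by_cases hcB : c ∈ B
      · exact join a ha haB haM c hcB
      · obtain ⟨m, hm, ham⟩ := attached a ha haB haM
        obtain ⟨m', hm', hcm⟩ := attached c hc hcB hcM
        exact hG.adj_of_common_adj hMc haM hac hm hm' ham hcm hb.2.1 hb.2.2 hba hbc

theorem IsSimplicial.not_btw {s : V} (hs : G.IsSimplicial s) (hconn : G.Connected) (x y : V) :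
    ¬ G.Btw x s y := by
  rintro ⟨hxs, hsy, -, h⟩
  obtain ⟨a, hsa, ha⟩ := hconn.exists_adj_dist_eq hxs.symm
  obtain ⟨b, hsb, hb⟩ := hconn.exists_adj_dist_eq hsy
  have h1 := hconn.dist_triangle (u := x) (v := a) (w := y)
  rw [G.dist_comm (u := x) (v := s), ha, G.dist_comm (u := a) (v := x)] at h
  rcases eq_or_ne a b with rfl | hab
  · omega
  · have h2 := hconn.dist_triangle (u := a) (v := b) (w := y)
    rw [dist_eq_one_iff_adj.2 (hs hsa hsb hab)] at h2
    omega

theorem left_mem_line (u v : V) : u ∈ G.line u v := by simp [line]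

theorem right_mem_line (u v : V) : v ∈ G.line u v := by simp [line]

theorem mem_line_of_btw {u v p : V} (h : G.Btw p u v ∨ G.Btw u p v ∨ G.Btw u v p) :
    p ∈ G.line u v := Or.inr h

/-- If `x` and `z` are adjacent and at the same nonzero distance from `s`, then `z` is not on the
line determined by `s` and `x`, and `s` is not on the line determined by `x` and `z`. -/
theorem not_mem_line_of_adj_of_dist_eq (hconn : G.Connected) {s x z : V} (hsz : z ≠ s)
    (h : G.Adj x z) (hd : G.dist s x = G.dist s z) : z ∉ G.line s x ∧ s ∉ G.line x z := by
  have h1 := dist_eq_one_iff_adj.2 h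
  have h2 := hconn.pos_dist_of_ne hsz.symm
  have h3 := G.dist_comm (u := x) (v := z)
  have h4 := G.dist_comm (u := z) (v := s)
  have h5 := G.dist_comm (u := x) (v := s)
  constructor
  · rintro ((rfl | rfl) | h | h | h)
    · exact hsz rfl
    · exact h.ne rfl
    all_goals
      have := h.2.2.2
      omega
  · rintro ((rfl | rfl) | h | h | h)
    · simp at hd
      omega
    · exact hsz rfl
    all_goals
      have := h.2.2.2
      omega

/-- If `x` lies between `s` and `y` and the pairs `s, x` and `s, y` determine the same line, then
`x` separates `s` from `y`. -/
theorem IsChordal.exists_separation [Finite V] (hG : G.IsChordal) (hconn : G.Connected)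
    {s x y : V} (hb : G.Btw s x y) (hl : G.line s x = G.line s y) :
    ∃ K : Set V, y ∈ K ∧ s ∉ K ∧ ∀ z ∉ K, ∀ z' ∈ K, G.Adj z z' → z = x := by
  obtain ⟨hsx, hxy, hsy, hd⟩ := hb
  have hdx := hconn.pos_dist_of_ne hsx
  have hdy := hconn.pos_dist_of_ne hxy
  obtain ⟨K, ⟨hyK, hKc, hKd⟩, hmax⟩ := (Set.toFinite {K : Set V | y ∈ K ∧
      (G.induce K).Preconnected ∧ ∀ k ∈ K, G.dist s x < G.dist s k}).exists_maximal
    ⟨{y}, by simp, by rintro ⟨a, rfl⟩ ⟨b, rfl⟩; rfl, by rintro k rfl; omega⟩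
  have hsK : s ∉ K := fun h => by simpa using hKd s h
  have hxK : x ∉ K := fun h => (hKd x h).false
  have level : ∀ z ∉ K, ∀ z' ∈ K, G.Adj z z' → G.dist s z = G.dist s x := by
    intro z hz z' hz' hzz
    have h1 := hconn.dist_le_dist_add_one s hzz.symm
    have h2 := hKd z' hz'
    have h3 : ¬ G.dist s x < G.dist s z := by
      intro h
      refine hz (hmax ⟨Set.mem_insert_of_mem z hyK, preconnected_induce_insert hKc hz' hzz, ?_⟩
        (Set.subset_insert z K) (Set.mem_insert z K))
      rintro k (rfl | hk)
      · exact h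
      · exact hKd k hk
    omega
  refine ⟨K, hyK, hsK, fun z hz z' hz' hzz => ?_⟩
  by_contra hzx
  obtain ⟨c, hc, c', hc', hcc, hcd⟩ := hconn.exists_boundary_dist_eq hyK hxK
  have hxc : x = c := by
    have h1 := hconn.dist_triangle (u := s) (v := c) (w := y)
    have h2 := level c hc c' hc' hcc
    exact hconn.dist_eq_zero_iff.1 (by omega)
  subst hxc
  have hzd := level z hz z' hz' hzz
  have hxz : G.Adj x z :=
    hG.adj_of_dist_eq hconn s hKc hKd rfl hzd (Ne.symm hzx) hc' hz' hcc hzz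
  obtain ⟨w, hw, hxw, hzw⟩ := hG.exists_common_adj hKc hxK hz hxz hc' hz' hcc hzz
  have hzs : z ≠ s := by
    rintro rfl
    simp at hzd
    omega
  have hz_not := (not_mem_line_of_adj_of_dist_eq hconn hzs hxz hzd.symm).1
  have hws : w ≠ s := by
    rintro rfl
    exact hsK hw
  have hwd : G.dist s w = G.dist s x + 1 := by
    have h1 := hconn.dist_le_dist_add_one s hxw.symm
    have h2 := hKd w hw
    omega
  have hxw1 := dist_eq_one_iff_adj.2 hxw
  have hzw1 := dist_eq_one_iff_adj.2 hzw
  have hw_mem : w ∈ G.line s y := by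
    rw [← hl]
    exact mem_line_of_btw (Or.inr (Or.inr ⟨hsx, hxw.ne, hws.symm, by omega⟩))
  have hwy : G.dist s w + G.dist w y = G.dist s y := by
    have h1 := hconn.dist_triangle (u := w) (v := x) (w := y)
    have h2 := G.dist_comm (u := w) (v := s)
    have h3 := G.dist_comm (u := w) (v := x)
    have h4 := G.dist_comm (u := w) (v := y)
    rcases hw_mem with (rfl | rfl) | h | h | h
    · exact (hws rfl).elim
    · simp
    · have := h.2.2.2
      omega
    · exact h.2.2.2
    · have := h.2.2.2
      omega
  refine hz_not (hl ▸ mem_line_of_btw (Or.inr (Or.inl ⟨hzs.symm, ?_, hsy, ?_⟩)))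
  · rintro rfl
    omega
  · have h1 := hconn.dist_triangle (u := z) (v := w) (w := y)
    have h2 := hconn.dist_triangle (u := s) (v := z) (w := y)
    omega

/-- If `s` is simplicial, `x` lies between `s` and `y`, and the pairs `s, x` and `s, y` determine
the same line, then the line determined by `x` and `y` is universal. -/
theorem IsChordal.line_eq_univ_of_btw [Finite V] (hG : G.IsChordal) (hconn : G.Connected)
    {s x y : V} (hs : G.IsSimplicial s) (hb : G.Btw s x y) (hl : G.line s x = G.line s y) :
    G.line x y = Set.univ := by
  obtain ⟨K, hyK, hsK, hK⟩ := hG.exists_separation hconn hb hl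
  obtain ⟨hsx, hxy, hsy, hd⟩ := hb
  refine Set.eq_univ_of_forall fun v => ?_
  rcases eq_or_ne v x with rfl | hvx
  · exact left_mem_line _ _
  rcases eq_or_ne v y with rfl | hvy
  · exact right_mem_line _ _
  by_cases hv : v ∈ K
  · obtain ⟨z, hz, z', hz', hzz, h⟩ := hconn.exists_boundary_dist_eq hv hsK
    obtain rfl := hK z hz z' hz' hzz
    have hsv : v ≠ s := by
      rintro rfl
      exact hsK hv
    have hmem : v ∈ G.line s y := by
      rw [← hl]
      exact mem_line_of_btw (Or.inr (Or.inr ⟨hsx, hvx.symm, hsv.symm, h.symm⟩))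
    rcases hmem with (rfl | rfl) | h' | h' | h'
    · exact (hsv rfl).elim
    · exact (hvy rfl).elim
    · exact (hs.not_btw hconn _ _ h').elim
    · have := h'.2.2.2
      exact mem_line_of_btw (Or.inr (Or.inl ⟨hvx.symm, hvy, hxy, by omega⟩))
    · have := h'.2.2.2
      exact mem_line_of_btw (Or.inr (Or.inr ⟨hxy, hvy.symm, hvx.symm, by omega⟩))
  · obtain ⟨z, hz, z', hz', hzz, h⟩ := hconn.exists_boundary_dist_eq hyK hv
    obtain rfl := hK z hz z' hz' hzz
    exact mem_line_of_btw (Or.inl ⟨hvx, hxy, hvy, h.symm⟩)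

/-- If no line is universal, then the lines determined by a simplicial vertex and each of the other
vertices are distinct. -/
theorem IsChordal.injOn_line [Finite V] (hG : G.IsChordal) (hconn : G.Connected)
    {s : V} (hs : G.IsSimplicial s) (hu : ∀ u v, u ≠ v → G.line u v ≠ Set.univ) :
    Set.InjOn (G.line s) {s}ᶜ := by
  intro x hx y hy hl
  by_contra hxy
  have hmem : y ∈ G.line s x := hl ▸ right_mem_line s y
  rcases hmem with (h | h) | h | h | h
  · exact hy h
  · exact hxy h.symm
  · exact hs.not_btw hconn _ _ h
  · exact hu y x (Ne.symm hxy) (hG.line_eq_univ_of_btw hconn hs h hl.symm)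
  · exact hu x y hxy (hG.line_eq_univ_of_btw hconn hs h hl)

/-- If no line is universal, then some line misses any given simplicial vertex. -/
theorem IsSimplicial.exists_not_mem_line [Nontrivial V] {s : V} (hs : G.IsSimplicial s)
    (hconn : G.Connected) (hu : ∀ u v, u ≠ v → G.line u v ≠ Set.univ) :
    ∃ u v, u ≠ v ∧ s ∉ G.line u v := by
  obtain ⟨r, hr⟩ := exists_ne s
  obtain ⟨a, hsa, -⟩ := hconn.exists_adj_dist_eq hr.symm
  obtain ⟨p, hp⟩ := (Set.ne_univ_iff_exists_notMem _).1 (hu s a hsa.ne)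
  have hps : p ≠ s := by
    rintro rfl
    exact hp (left_mem_line _ _)
  have hpa : p ≠ a := by
    rintro rfl
    exact hp (right_mem_line _ _)
  obtain ⟨b, hsb, hb⟩ := hconn.exists_adj_dist_eq hps.symm
  have hab : a ≠ b := by
    rintro rfl
    refine hp (mem_line_of_btw (Or.inr (Or.inr ⟨hsa.ne, hpa.symm, hps.symm, ?_⟩)))
    rw [dist_eq_one_iff_adj.2 hsa]
    omega
  refine ⟨a, b, hab, (not_mem_line_of_adj_of_dist_eq hconn hsb.ne' (hs hsa hsb hab) ?_).2⟩
  rw [dist_eq_one_iff_adj.2 hsa, dist_eq_one_iff_adj.2 hsb]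

end SimpleGraph

/-- Theorem: the metric space induced by a connected chordal graph on `n ≥ 2`
vertices either has at least `n` distinct lines or has a line consisting of all
`n` vertices. -/
theorem stmt3 {V : Type*} [Fintype V] (G : SimpleGraph V) (hconn : G.Connected)
    (hG : G.IsChordal) (n : ℕ) (hn : Fintype.card V = n) (h2 : 2 ≤ n) :
    n ≤ {L : Set V | ∃ u v : V, u ≠ v ∧ L = G.line u v}.ncard ∨
      ∃ u v : V, u ≠ v ∧ G.line u v = Set.univ := by
  by_contra! hcon
  obtain ⟨hlt, hu⟩ := hcon
  have : Nontrivial V := Fintype.one_lt_card_iff_nontrivial.1 (by omega)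
  obtain ⟨s, -, hs⟩ := hG.exists_simplicial_mem Set.univ Set.univ_nonempty
  have hs : G.IsSimplicial s := fun a b ha hb hab => hs a trivial b trivial ha hb hab
  obtain ⟨u, v, huv, hsuv⟩ := hs.exists_not_mem_line hconn hu
  have hnot : G.line u v ∉ G.line s '' {s}ᶜ := by
    rintro ⟨x, -, hx⟩
    exact hsuv (hx ▸ SimpleGraph.left_mem_line s x)
  have hsub : insert (G.line u v) (G.line s '' {s}ᶜ) ⊆
      {L : Set V | ∃ u v : V, u ≠ v ∧ L = G.line u v} := by
    rintro L (rfl | ⟨x, hx, rfl⟩)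
    · exact ⟨u, v, huv, rfl⟩
    · exact ⟨s, x, Ne.symm hx, rfl⟩
  have hle := Set.ncard_le_ncard hsub
  rw [Set.ncard_insert_of_notMem hnot, (hG.injOn_line hconn hs hu).ncard_image, Set.ncard_compl,
    Set.ncard_singleton, Nat.card_eq_fintype_card] at hle
  omega
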